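/- arXiv:0906.1856 — 2 statements merged into one kernel-verified Lean document; each statement's English description precedes it below -/
import Mathlib

section
/- Fix s ≥ 0 and y > 0, and let f : ℝ → ℝ be a C^∞ function with compact support contained in (0,∞). Then lim_{t→s⁺} [ (∫_{[0,∞)} f(x) H_{s,t}(y,dx) − f(y)) / (t−s) ] = −β(s)·y·f′(y) + (σ²(s)/2)·y·f″(y). -/
open MeasureTheory Filter Set

/-- `C(s,t) = ∫_s^t (σ²(v)/2)·exp(∫_0^v β(u)du) dv` -/
noncomputable def Cf (σ β : ℝ → ℝ) (s t : ℝ) : ℝ :=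
  ∫ v in s..t, σ v ^ 2 / 2 * Real.exp (∫ u in (0:ℝ)..v, β u)

/-- `B(s,t) = exp(−∫_s^t β(v)dv)` -/
noncomputable def Bf (β : ℝ → ℝ) (s t : ℝ) : ℝ :=
  Real.exp (-∫ v in s..t, β v)

/-- `p(s,t) = 1/(B(0,t)·C(s,t))` -/
noncomputable def pf (σ β : ℝ → ℝ) (s t : ℝ) : ℝ :=
  1 / (Bf β 0 t * Cf σ β s t)

/-- `γ(s,t) = 1/(B(0,s)·C(s,t))` -/
noncomputable def gf (σ β : ℝ → ℝ) (s t : ℝ) : ℝ :=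
  1 / (Bf β 0 s * Cf σ β s t)

open ProbabilityTheory in
/-- The Poisson(θ)-mixture of Gamma laws: weight `e^{−θ}` on the Dirac measure at `0` and
weight `e^{−θ}θ^m/m!` on the Gamma law `Γ(m,p)` for `m ≥ 1`. -/
noncomputable def poissonGammaMix (θ p : ℝ) : Measure ℝ :=
  ENNReal.ofReal (Real.exp (-θ)) • Measure.dirac 0 +
  Measure.sum (fun m : ℕ =>
    ENNReal.ofReal (Real.exp (-θ) * θ ^ (m + 1) / (Nat.factorial (m + 1))) •
      gammaMeasure ((m : ℝ) + 1) p)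

/-- `H_{s,t}(y,·) = e^{−y·γ(s,t)}·δ₀ + Σ_{m≥1} (e^{−y·γ(s,t)}(y·γ(s,t))^m/m!)·Γ(m,p(s,t))`. -/
noncomputable def Hm (σ β : ℝ → ℝ) (s t y : ℝ) : Measure ℝ :=
  poissonGammaMix (y * gf σ β s t) (pf σ β s t)

open ProbabilityTheory in
lemma lintegral_id_mul_gammaMeasure {a r : ℝ} (ha : 0 < a) (hr : 0 < r) {g : ℝ → ENNReal}
    (hg : Measurable g) :
    ∫⁻ x, ENNReal.ofReal x * g x ∂(gammaMeasure a r) =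
      ENNReal.ofReal (a / r) * ∫⁻ x, g x ∂(gammaMeasure (a + 1) r) := by
  have hm : ∀ b, Measurable (gammaPDF b r) := fun b =>
    (measurable_gammaPDFReal b r).ennreal_ofReal
  rw [gammaMeasure, gammaMeasure,
    lintegral_withDensity_eq_lintegral_mul _ (hm _) (by fun_prop),
    lintegral_withDensity_eq_lintegral_mul _ (hm _) hg,
    ← lintegral_const_mul _ ((hm _).mul hg)]
  refine lintegral_congr fun x => ?_
  simp only [Pi.mul_apply]
  rcases lt_or_ge x 0 with hx | hx
  · simp [gammaPDF_of_neg hx]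
  · rw [mul_left_comm, ← mul_assoc, ← mul_assoc]
    congr 1
    rw [gammaPDF, gammaPDF, ← ENNReal.ofReal_mul hx, ← ENNReal.ofReal_mul (by positivity)]
    congr 1
    have hG := (Real.Gamma_pos_of_pos ha).ne'
    rcases hx.eq_or_lt with rfl | hx
    · simp [gammaPDFReal, Real.zero_rpow ha.ne']
    · simp only [gammaPDFReal, if_pos hx.le, add_sub_cancel_right, Real.Gamma_add_one ha.ne',
        Real.rpow_add_one hr.ne', Real.rpow_sub_one hx.ne']
      field_simp

open ProbabilityTheory in
lemma lintegral_pow_gammaMeasure {r : ℝ} (hr : 0 < r) (k : ℕ) {a : ℝ} (ha : 0 < a) :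
    ∫⁻ x, ENNReal.ofReal x ^ k ∂(gammaMeasure a r) =
      ENNReal.ofReal ((ascPochhammer ℝ k).eval a / r ^ k) := by
  induction k generalizing a with
  | zero =>
    have := isProbabilityMeasure_gammaMeasure ha hr
    simp
  | succ k ih =>
    simp_rw [pow_succ']
    rw [lintegral_id_mul_gammaMeasure ha hr (by fun_prop), ih (by positivity),
      ← ENNReal.ofReal_mul (by positivity), ascPochhammer_succ_left]
    congr 1
    simp [Polynomial.eval_comp]
    field_simp

open ProbabilityTheory in
lemma ae_nonneg_gammaMeasure (a r : ℝ) : ∀ᵐ x ∂(gammaMeasure a r), 0 ≤ x := by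
  have hm : Measurable (gammaPDF a r) := (measurable_gammaPDFReal a r).ennreal_ofReal
  rw [gammaMeasure, ae_withDensity_iff hm]
  refine ae_of_all _ fun x hx => ?_
  by_contra h
  exact hx (gammaPDF_of_neg (not_le.mp h))

open ProbabilityTheory in
lemma integrable_pow_gammaMeasure {a r : ℝ} (ha : 0 < a) (hr : 0 < r) (k : ℕ) :
    Integrable (fun x => x ^ k) (gammaMeasure a r) := by
  refine ⟨by fun_prop, ?_⟩
  rw [HasFiniteIntegral, lintegral_congr_ae (g := fun x => ENNReal.ofReal x ^ k),
    lintegral_pow_gammaMeasure hr k ha]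
  · exact ENNReal.ofReal_lt_top
  · filter_upwards [ae_nonneg_gammaMeasure a r] with x hx
    rw [← ENNReal.ofReal_pow hx, Real.enorm_of_nonneg (by positivity)]

open ProbabilityTheory in
lemma integral_pow_gammaMeasure {a r : ℝ} (ha : 0 < a) (hr : 0 < r) (k : ℕ) :
    ∫ x, x ^ k ∂(gammaMeasure a r) = (ascPochhammer ℝ k).eval a / r ^ k := by
  rw [integral_eq_lintegral_of_nonneg_ae, lintegral_congr_ae (g := fun x => ENNReal.ofReal x ^ k),
    lintegral_pow_gammaMeasure hr k ha, ENNReal.toReal_ofReal]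
  · have := ascPochhammer_pos k a ha
    positivity
  · filter_upwards [ae_nonneg_gammaMeasure a r] with x hx
    rw [← ENNReal.ofReal_pow hx]
  · filter_upwards [ae_nonneg_gammaMeasure a r] with x hx
    exact pow_nonneg hx k
  · fun_prop

/-- If the rising factorial moment of order `k` of the Poisson law is `M`, then the Poisson-Gamma
mixture has `k`-th moment `M / p ^ k`. -/
lemma poissonGammaMix_moment {θ p : ℝ} (hθ : 0 < θ) (hp : 0 < p) (k : ℕ) {M : ℝ}
    (hM : HasSum (fun n : ℕ => θ ^ n / n.factorial * (ascPochhammer ℝ k).eval (n : ℝ))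
      (Real.exp θ * M)) :
    Integrable (fun x => x ^ k) (poissonGammaMix θ p) ∧
      ∫ x, x ^ k ∂(poissonGammaMix θ p) = M / p ^ k := by
  have hterm : ∀ m : ℕ, ∫ x, x ^ k ∂(ENNReal.ofReal (Real.exp (-θ) * θ ^ (m + 1) /
      (Nat.factorial (m + 1))) • ProbabilityTheory.gammaMeasure ((m : ℝ) + 1) p) =
      Real.exp (-θ) / p ^ k * (θ ^ (m + 1) / (m + 1).factorial *
        (ascPochhammer ℝ k).eval ((m + 1 : ℕ) : ℝ)) := by
    intro m
    rw [integral_smul_measure, integral_pow_gammaMeasure (by positivity) hp,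
      ENNReal.toReal_ofReal (by positivity)]
    push_cast
    simp only [smul_eq_mul]
    ring
  have hnonneg : ∀ m : ℕ, ∀ᵐ x ∂(ENNReal.ofReal (Real.exp (-θ) * θ ^ (m + 1) /
      (Nat.factorial (m + 1))) • ProbabilityTheory.gammaMeasure ((m : ℝ) + 1) p), 0 ≤ x :=
    fun m => Measure.ae_smul_measure (ae_nonneg_gammaMeasure _ _) _
  have hs := ((hasSum_nat_add_iff' 1).mpr hM).mul_left (Real.exp (-θ) / p ^ k)
  have hint : Integrable (fun x => x ^ k) (Measure.sum (fun m : ℕ =>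
      ENNReal.ofReal (Real.exp (-θ) * θ ^ (m + 1) / (Nat.factorial (m + 1))) •
      ProbabilityTheory.gammaMeasure ((m : ℝ) + 1) p)) := by
    refine integrable_sum_measure (fun m => (integrable_pow_gammaMeasure (by positivity) hp
      k).smul_measure ENNReal.ofReal_ne_top) (hs.summable.congr fun m => ?_)
    rw [← hterm m]
    refine integral_congr_ae ?_
    filter_upwards [hnonneg m] with x hx
    rw [Real.norm_of_nonneg (by positivity)]
  have hd : Integrable (fun x : ℝ => x ^ k)
      (ENNReal.ofReal (Real.exp (-θ)) • Measure.dirac (0 : ℝ)) :=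
    (integrable_dirac (by simp)).smul_measure ENNReal.ofReal_ne_top
  refine ⟨hd.add_measure hint, ?_⟩
  have h2 := hasSum_integral_measure hint
  simp_rw [hterm] at h2
  rw [poissonGammaMix, integral_add_measure hd hint, h2.unique hs, integral_smul_measure,
    integral_dirac, ENNReal.toReal_ofReal (by positivity), Real.exp_neg]
  have := (Real.exp_pos θ).ne'
  rcases k with _ | k
  · simp
    field_simp
    ring
  · simp
    field_simp

lemma hasSum_pow_div_factorial_mul {θ A : ℝ} {g : ℝ → ℝ}
    (h : HasSum (fun n : ℕ => θ ^ n / n.factorial * g (n + 1)) A) :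
    HasSum (fun n : ℕ => θ ^ n / n.factorial * (n * g n)) (θ * A) := by
  rw [← hasSum_nat_add_iff' 1]
  convert! h.mul_left θ using 1
  · ext n
    rw [Nat.factorial_succ]
    push_cast
    field_simp
    ring
  · simp

lemma hasSum_pow_div_factorial (θ : ℝ) :
    HasSum (fun n : ℕ => θ ^ n / n.factorial) (Real.exp θ) := by
  rw [Real.exp_eq_exp_ℝ]
  exact NormedSpace.expSeries_div_hasSum_exp θ

/-- The rising factorial moments of the Poisson law, up to order four. -/
lemma hasSum_poisson_ascPochhammer (θ : ℝ) :
    HasSum (fun n : ℕ => θ ^ n / n.factorial * (ascPochhammer ℝ 0).eval (n : ℝ))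
      (Real.exp θ * 1) ∧
    HasSum (fun n : ℕ => θ ^ n / n.factorial * (ascPochhammer ℝ 1).eval (n : ℝ))
      (Real.exp θ * θ) ∧
    HasSum (fun n : ℕ => θ ^ n / n.factorial * (ascPochhammer ℝ 2).eval (n : ℝ))
      (Real.exp θ * (θ ^ 2 + 2 * θ)) ∧
    HasSum (fun n : ℕ => θ ^ n / n.factorial * (ascPochhammer ℝ 3).eval (n : ℝ))
      (Real.exp θ * (θ ^ 3 + 6 * θ ^ 2 + 6 * θ)) ∧
    HasSum (fun n : ℕ => θ ^ n / n.factorial * (ascPochhammer ℝ 4).eval (n : ℝ))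
      (Real.exp θ * (θ ^ 4 + 12 * θ ^ 3 + 36 * θ ^ 2 + 24 * θ)) := by
  have h0 := hasSum_pow_div_factorial θ
  have h0' : HasSum (fun n : ℕ => θ ^ n / n.factorial * 1) (Real.exp θ) := by simpa using h0
  have h1 := hasSum_pow_div_factorial_mul (g := fun _ => 1) h0'
  have h2 := hasSum_pow_div_factorial_mul (g := fun x => x - 1)
    (by simpa only [add_sub_cancel_right, mul_one] using h1)
  have h3 := hasSum_pow_div_factorial_mul (g := fun x => (x - 1) * (x - 1 - 1))
    (by simpa only [add_sub_cancel_right, mul_one] using h2)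
  have h4 := hasSum_pow_div_factorial_mul (g := fun x => (x - 1) * ((x - 1 - 1) * (x - 1 - 1 - 1)))
    (by simpa only [add_sub_cancel_right, mul_one] using h3)
  refine ⟨by simpa using h0, ?_, ?_, ?_, ?_⟩
  · convert! h1 using 1
    · simp
    · ring
  · convert! h2.add (h1.mul_left 2) using 1
    · ext n
      simp [ascPochhammer_succ_eval]
      ring
    · ring
  · convert! (h3.add (h2.mul_left 6)).add (h1.mul_left 6) using 1
    · ext n
      simp [ascPochhammer_succ_eval]
      ring
    · ring
  · convert! ((h4.add (h3.mul_left 12)).add (h2.mul_left 36)).add (h1.mul_left 24) using 1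
    · ext n
      simp [ascPochhammer_succ_eval]
      ring
    · ring

open ProbabilityTheory in
lemma isProbabilityMeasure_poissonGammaMix {θ p : ℝ} (hθ : 0 < θ) (hp : 0 < p) :
    IsProbabilityMeasure (poissonGammaMix θ p) := by
  obtain ⟨hi, h⟩ := poissonGammaMix_moment hθ hp 0 (hasSum_poisson_ascPochhammer θ).1
  have : IsFiniteMeasure (poissonGammaMix θ p) := by
    simpa [integrable_const_iff] using hi
  refine ⟨?_⟩
  rw [← ENNReal.toReal_eq_one_iff]
  simpa [Measure.real] using h

/-- Moments of the Poisson-Gamma mixture with `θ = a / q`, `p = 1 / q` about a point `y`. -/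
lemma poissonGammaMix_centered_moments {a q : ℝ} (ha : 0 < a) (hq : 0 < q) (y : ℝ) :
    Integrable (fun x => x - y) (poissonGammaMix (a / q) (1 / q)) ∧
    Integrable (fun x => (x - y) ^ 2) (poissonGammaMix (a / q) (1 / q)) ∧
    Integrable (fun x => (x - y) ^ 4) (poissonGammaMix (a / q) (1 / q)) ∧
    ∫ x, (x - y) ∂(poissonGammaMix (a / q) (1 / q)) = a - y ∧
    ∫ x, (x - y) ^ 2 ∂(poissonGammaMix (a / q) (1 / q)) = (a - y) ^ 2 + 2 * a * q ∧
    ∫ x, (x - y) ^ 4 ∂(poissonGammaMix (a / q) (1 / q)) =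
      (a - y) ^ 4 + 12 * a * q * (a - y) ^ 2 + 12 * a ^ 2 * q ^ 2 + 24 * a * q ^ 2 * (a - y) +
        24 * a * q ^ 3 := by
  have hθ : 0 < a / q := by positivity
  have hp : 0 < 1 / q := by positivity
  have := isProbabilityMeasure_poissonGammaMix hθ hp
  obtain ⟨-, s1, s2, s3, s4⟩ := hasSum_poisson_ascPochhammer (a / q)
  obtain ⟨i1, m1⟩ := poissonGammaMix_moment hθ hp 1 s1
  obtain ⟨i2, m2⟩ := poissonGammaMix_moment hθ hp 2 s2
  obtain ⟨i3, m3⟩ := poissonGammaMix_moment hθ hp 3 s3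
  obtain ⟨i4, m4⟩ := poissonGammaMix_moment hθ hp 4 s4
  simp only [pow_one] at i1 m1
  set μ := poissonGammaMix (a / q) (1 / q)
  have e2 : (fun x : ℝ => (x - y) ^ 2) = fun x => (x ^ 2 - 2 * y * x) + y ^ 2 := by
    ext x; ring
  have e4 : (fun x : ℝ => (x - y) ^ 4) =
      fun x => ((x ^ 4 - 4 * y * x ^ 3) + 6 * y ^ 2 * x ^ 2 - 4 * y ^ 3 * x) + y ^ 4 := by
    ext x; ring
  have j2 : Integrable (fun x : ℝ => x ^ 2 - 2 * y * x) μ := i2.sub (i1.const_mul _)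
  have j3 : Integrable (fun x : ℝ => x ^ 4 - 4 * y * x ^ 3) μ := i4.sub (i3.const_mul _)
  have j4 : Integrable (fun x : ℝ => x ^ 4 - 4 * y * x ^ 3 + 6 * y ^ 2 * x ^ 2) μ :=
    j3.add (i2.const_mul _)
  have j5 : Integrable (fun x : ℝ => x ^ 4 - 4 * y * x ^ 3 + 6 * y ^ 2 * x ^ 2 - 4 * y ^ 3 * x) μ :=
    j4.sub (i1.const_mul _)
  refine ⟨i1.sub (integrable_const _), e2 ▸ j2.add (integrable_const _),
    e4 ▸ j5.add (integrable_const _), ?_, ?_, ?_⟩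
  · rw [integral_sub i1 (integrable_const _), m1]
    simp
    field_simp
  · rw [e2, integral_add j2 (integrable_const _), integral_sub i2 (i1.const_mul _),
      integral_const_mul, m1, m2]
    simp
    field_simp
    ring
  · rw [e4, integral_add j5 (integrable_const _), integral_sub j4 (i1.const_mul _),
      integral_add j3 (i2.const_mul _), integral_sub i4 (i3.const_mul _),
      integral_const_mul, integral_const_mul, integral_const_mul, m1, m2, m3, m4]
    simp
    field_simp
    ring

lemma exists_taylor_two_bound {f : ℝ → ℝ} (hf : ContDiff ℝ 3 f)
    (hsupp : HasCompactSupport f) (y : ℝ) :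
    ∃ K, 0 ≤ K ∧ ∀ x, |f x - f y - deriv f y * (x - y) - deriv (deriv f) y / 2 * (x - y) ^ 2| ≤
      K * |x - y| ^ 3 := by
  have hc : Continuous (iteratedDeriv 3 f) := hf.continuous_iteratedDeriv 3 le_rfl
  have hs3 : HasCompactSupport (iteratedDeriv 3 f) := by
    rw [iteratedDeriv_eq_iterate]
    exact hsupp.deriv.deriv.deriv
  obtain ⟨K, hK⟩ := hs3.exists_bound_of_continuous hc
  have hK0 : 0 ≤ K := (norm_nonneg _).trans (hK 0)
  refine ⟨K, hK0, fun x => ?_⟩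
  rcases eq_or_ne y x with rfl | hx
  · simp
  obtain ⟨z, -, hz⟩ := taylor_mean_remainder_lagrange_iteratedDeriv (n := 2) hx
    (hf.contDiffOn.of_le (by norm_num))
  have hu := uniqueDiffOn_uIcc hx
  have h1 : iteratedDerivWithin 1 f (uIcc y x) y = deriv f y := by
    rw [iteratedDerivWithin_eq_iteratedDeriv hu (hf.of_le (by norm_num)).contDiffAt left_mem_uIcc,
      iteratedDeriv_one]
  have h2 : iteratedDerivWithin 2 f (uIcc y x) y = deriv (deriv f) y := by
    rw [iteratedDerivWithin_eq_iteratedDeriv hu (hf.of_le (by norm_num)).contDiffAt left_mem_uIcc,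
      iteratedDeriv_eq_iterate]
    rfl
  have hT : f x - f y - deriv f y * (x - y) - deriv (deriv f) y / 2 * (x - y) ^ 2 =
      f x - taylorWithinEval f 2 (uIcc y x) y x := by
    rw [taylorWithinEval_succ, taylorWithinEval_succ, taylor_within_zero_eval]
    norm_num [h1, h2]
    ring
  rw [hT, hz, abs_div, abs_mul, abs_pow]
  have h3 : (1 : ℝ) ≤ |((2 + 1).factorial : ℝ)| := by norm_num [Nat.factorial]
  refine (div_le_self (by positivity) h3).trans ?_
  gcongr
  exact hK z

/-- A family of probability measures concentrating at `y`, with first and second moments about `y`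
of order `h` and fourth moment of order `h ^ 2`, acts on smooth functions like `b ∂ + c / 2 ∂²`. -/
lemma tendsto_integral_sub_div_of_moments {ι : Type*} {l : Filter ι} {μ : ι → Measure ℝ}
    {h : ι → ℝ} {f : ℝ → ℝ} {y b c d : ℝ} (hf : ContDiff ℝ 3 f) (hsupp : HasCompactSupport f)
    (hh : ∀ᶠ t in l, 0 < h t) (hh0 : Tendsto h l (nhds 0))
    (hμ : ∀ᶠ t in l, IsProbabilityMeasure (μ t))
    (i1 : ∀ᶠ t in l, Integrable (fun x => x - y) (μ t))
    (i2 : ∀ᶠ t in l, Integrable (fun x => (x - y) ^ 2) (μ t))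
    (i4 : ∀ᶠ t in l, Integrable (fun x => (x - y) ^ 4) (μ t))
    (m1 : Tendsto (fun t => (∫ x, (x - y) ∂μ t) / h t) l (nhds b))
    (m2 : Tendsto (fun t => (∫ x, (x - y) ^ 2 ∂μ t) / h t) l (nhds c))
    (m4 : Tendsto (fun t => (∫ x, (x - y) ^ 4 ∂μ t) / h t ^ 2) l (nhds d)) :
    Tendsto (fun t => ((∫ x, f x ∂μ t) - f y) / h t) l
      (nhds (b * deriv f y + c / 2 * deriv (deriv f) y)) := by
  obtain ⟨K, hK0, hK⟩ := exists_taylor_two_bound hf hsupp y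
  have hsq : Tendsto (fun t => Real.sqrt (h t)) l (nhds 0) := by
    simpa [Function.comp_def] using (Real.continuous_sqrt.tendsto 0).comp hh0
  have hmain : Tendsto (fun t => (∫ x, (x - y) ∂μ t) / h t * deriv f y +
      (∫ x, (x - y) ^ 2 ∂μ t) / h t / 2 * deriv (deriv f) y) l
      (nhds (b * deriv f y + c / 2 * deriv (deriv f) y)) :=
    (m1.mul_const _).add ((m2.div_const _).mul_const _)
  have hbound : Tendsto (fun t => K * (Real.sqrt (h t) * ((∫ x, (x - y) ^ 2 ∂μ t) / h t) +
      Real.sqrt (h t) * ((∫ x, (x - y) ^ 4 ∂μ t) / h t ^ 2))) l (nhds 0) := by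
    simpa using ((hsq.mul m2).add (hsq.mul m4)).const_mul K
  have hrem : Tendsto (fun t => ((∫ x, f x ∂μ t) - f y) / h t -
      ((∫ x, (x - y) ∂μ t) / h t * deriv f y +
      (∫ x, (x - y) ^ 2 ∂μ t) / h t / 2 * deriv (deriv f) y)) l (nhds 0) := by
    refine squeeze_zero_norm' ?_ hbound
    filter_upwards [hh, hμ, i1, i2, i4] with t ht hμt j1 j2 j4
    have jf : Integrable f (μ t) := hf.continuous.integrable_of_hasCompactSupport hsupp
    have jA : Integrable (fun x => f x - f y) (μ t) := jf.sub (integrable_const _)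
    have jB : Integrable (fun x => f x - f y - deriv f y * (x - y)) (μ t) :=
      jA.sub (j1.const_mul _)
    have hs := Real.sqrt_pos.mpr ht
    have hss := Real.sq_sqrt ht.le
    set δ := Real.sqrt (h t)
    have heq : ((∫ x, f x ∂μ t) - f y) / h t - ((∫ x, (x - y) ∂μ t) / h t * deriv f y +
        (∫ x, (x - y) ^ 2 ∂μ t) / h t / 2 * deriv (deriv f) y) =
        (∫ x, (f x - f y - deriv f y * (x - y) - deriv (deriv f) y / 2 * (x - y) ^ 2) ∂μ t) /
          h t := by
      rw [integral_sub jB (j2.const_mul _), integral_sub jA (j1.const_mul _),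
        integral_sub jf (integrable_const _), integral_const_mul, integral_const_mul]
      simp
      ring
    have hle : ‖∫ x, (f x - f y - deriv f y * (x - y) - deriv (deriv f) y / 2 * (x - y) ^ 2) ∂μ t‖
        ≤ ∫ x, (K * δ * (x - y) ^ 2 + K / δ * (x - y) ^ 4) ∂μ t := by
      refine norm_integral_le_of_norm_le ((j2.const_mul _).add (j4.const_mul _))
        (ae_of_all _ fun x => ?_)
      refine (hK x).trans ?_
      have h2 : (x - y) ^ 2 = |x - y| ^ 2 := (sq_abs _).symm
      have h4 : (x - y) ^ 4 = |x - y| ^ 4 := by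
        rw [← abs_pow, abs_of_nonneg (by positivity)]
      rw [h2, h4]
      have hx := abs_nonneg (x - y)
      set r := |x - y|
      have key : r ^ 3 ≤ δ * r ^ 2 + r ^ 4 / δ := by
        rw [← sub_nonneg, show δ * r ^ 2 + r ^ 4 / δ - r ^ 3 =
          r ^ 2 * (δ ^ 2 + r ^ 2 - δ * r) / δ by field_simp]
        have : 0 ≤ δ ^ 2 + r ^ 2 - δ * r := by nlinarith [sq_nonneg (δ - r)]
        positivity
      calc K * r ^ 3 ≤ K * (δ * r ^ 2 + r ^ 4 / δ) := by gcongr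
        _ = _ := by ring
    rw [heq, norm_div, Real.norm_of_nonneg ht.le]
    refine (div_le_div_of_nonneg_right hle ht.le).trans (le_of_eq ?_)
    rw [integral_add (j2.const_mul _) (j4.const_mul _), integral_const_mul, integral_const_mul,
      ← hss]
    field_simp
  simpa using hrem.add hmain

/-- The mixture with `θ = a / q`, `p = 1 / q`, where `a` moves away from `y` with speed `α` and
`q` away from `0` with speed `κ`. -/
lemma tendsto_poissonGammaMix_sub_div {ι : Type*} {l : Filter ι} {a q h : ι → ℝ}
    {f : ℝ → ℝ} {y α κ : ℝ} (hf : ContDiff ℝ 3 f) (hsupp : HasCompactSupport f)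
    (hh : ∀ᶠ t in l, 0 < h t) (hh0 : Tendsto h l (nhds 0))
    (ha : ∀ᶠ t in l, 0 < a t) (hq : ∀ᶠ t in l, 0 < q t)
    (hα : Tendsto (fun t => (a t - y) / h t) l (nhds α))
    (hκ : Tendsto (fun t => q t / h t) l (nhds κ)) :
    Tendsto (fun t => ((∫ x, f x ∂(poissonGammaMix (a t / q t) (1 / q t))) - f y) / h t) l
      (nhds (α * deriv f y + κ * y * deriv (deriv f) y)) := by
  have hay : Tendsto a l (nhds y) := by
    have h1 : Tendsto (fun t => (a t - y) / h t * h t + y) l (nhds y) := by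
      simpa using (hα.mul hh0).add_const y
    refine h1.congr' ?_
    filter_upwards [hh] with t ht
    field_simp
    ring
  have key := tendsto_integral_sub_div_of_moments
    (μ := fun t => poissonGammaMix (a t / q t) (1 / q t)) (h := h) (l := l) (y := y)
    (b := α) (c := 2 * y * κ) (d := 12 * y ^ 2 * κ ^ 2) hf hsupp hh hh0 ?_ ?_ ?_ ?_ ?_ ?_ ?_
  · convert key using 2
    ring
  · filter_upwards [ha, hq] with t ha hq
    exact isProbabilityMeasure_poissonGammaMix (by positivity) (by positivity)
  · filter_upwards [ha, hq] with t ha hq using (poissonGammaMix_centered_moments ha hq y).1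
  · filter_upwards [ha, hq] with t ha hq using (poissonGammaMix_centered_moments ha hq y).2.1
  · filter_upwards [ha, hq] with t ha hq using (poissonGammaMix_centered_moments ha hq y).2.2.1
  · refine hα.congr' ?_
    filter_upwards [ha, hq] with t ha hq
    rw [(poissonGammaMix_centered_moments ha hq y).2.2.2.1]
  · have h2 : Tendsto (fun t => h t * ((a t - y) / h t) ^ 2 + 2 * a t * (q t / h t)) l
        (nhds (2 * y * κ)) := by
      simpa using (hh0.mul (hα.pow 2)).add ((hay.const_mul 2).mul hκ)
    refine h2.congr' ?_
    filter_upwards [ha, hq, hh] with t ha hq ht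
    rw [(poissonGammaMix_centered_moments ha hq y).2.2.2.2.1]
    field_simp
  · have h4 : Tendsto (fun t => h t ^ 2 * ((a t - y) / h t) ^ 4 +
        12 * a t * (q t / h t) * (h t * ((a t - y) / h t) ^ 2) +
        12 * a t ^ 2 * (q t / h t) ^ 2 + 24 * a t * (q t / h t) ^ 2 * (h t * ((a t - y) / h t)) +
        24 * a t * (h t * (q t / h t) ^ 3)) l (nhds (12 * y ^ 2 * κ ^ 2)) := by
      simpa using (((((hh0.pow 2).mul (hα.pow 4)).add
        (((hay.const_mul 12).mul hκ).mul (hh0.mul (hα.pow 2)))).add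
        (((hay.pow 2).const_mul 12).mul (hκ.pow 2))).add
        (((hay.const_mul 24).mul (hκ.pow 2)).mul (hh0.mul hα))).add
        ((hay.const_mul 24).mul (hh0.mul (hκ.pow 3)))
    refine h4.congr' ?_
    filter_upwards [ha, hq, hh] with t ha hq ht
    rw [(poissonGammaMix_centered_moments ha hq y).2.2.2.2.2]
    field_simp

/-- Generator of the semigroup `(H_{s,t})` on test functions supported in `(0,∞)`:
`lim_{t↓s} (H_{s,t}f − f)(y)/(t−s) = −β(s)·y·f′(y) + (σ²(s)/2)·y·f″(y)`. -/
theorem stmt_12 (σ β : ℝ → ℝ)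
    (hσc : ContinuousOn σ (Set.Ici 0)) (hβc : ContinuousOn β (Set.Ici 0))
    (hσpos : ∀ x ∈ Set.Ici (0:ℝ), 0 < σ x) (hβnn : ∀ x ∈ Set.Ici (0:ℝ), 0 ≤ β x)
    (s y : ℝ) (hs : 0 ≤ s) (hy : 0 < y)
    (f : ℝ → ℝ) (hf : ContDiff ℝ (⊤ : ℕ∞) f) (hsupp : HasCompactSupport f)
    (hsupp' : tsupport f ⊆ Set.Ioi 0) :
    Filter.Tendsto
      (fun t => ((∫ x, f x ∂(Hm σ β s t y)) - f y) / (t - s))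
      (nhdsWithin s (Set.Ioi s))
      (nhds (-(β s) * y * deriv f y + σ s ^ 2 / 2 * y * deriv (deriv f) y)) := by
  have hproj : ∀ v : ℝ, max v 0 ∈ Set.Ici (0 : ℝ) := fun v => le_max_right v 0
  set β' : ℝ → ℝ := fun v => β (max v 0)
  set σ' : ℝ → ℝ := fun v => σ (max v 0)
  have hβ' : Continuous β' := hβc.comp_continuous (by fun_prop) hproj
  have hσ' : Continuous σ' := hσc.comp_continuous (by fun_prop) hproj
  have hβ_eq : ∀ v, 0 ≤ v → β v = β' v := fun v hv => by simp only [β', max_eq_left hv]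
  have hσ_eq : ∀ v, 0 ≤ v → σ v = σ' v := fun v hv => by simp only [σ', max_eq_left hv]
  have hI : ∀ u v, 0 ≤ u → u ≤ v → ∫ r in u..v, β r = ∫ r in u..v, β' r := fun u v hu huv =>
    intervalIntegral.integral_congr fun r hr => hβ_eq r (hu.trans (uIcc_of_le huv ▸ hr).1)
  set E : ℝ → ℝ := fun v => ∫ u in (0 : ℝ)..v, β' u
  have hE : ∀ v, HasDerivAt E (β' v) v := fun v =>
    (hβ'.integral_hasStrictDerivAt 0 v).hasDerivAt
  have hEc : Continuous E := continuous_iff_continuousAt.mpr fun v => (hE v).continuousAt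
  set w : ℝ → ℝ := fun v => σ' v ^ 2 / 2 * Real.exp (E v)
  have hw : Continuous w := by fun_prop
  have hwpos : ∀ v, 0 < w v := fun v => by
    have : 0 < σ' v := hσpos _ (hproj v)
    positivity
  set C : ℝ → ℝ := fun t => ∫ v in s..t, w v
  have hC : HasDerivAt C (w s) s := (hw.integral_hasStrictDerivAt s s).hasDerivAt
  have hC_eq : ∀ t, s ≤ t → Cf σ β s t = C t := fun t ht =>
    intervalIntegral.integral_congr fun v hv => by
      have hv0 : 0 ≤ v := hs.trans (uIcc_of_le ht ▸ hv).1
      simp only [w, E, hσ_eq v hv0, hI 0 v le_rfl hv0]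
  have hB_eq : ∀ t, 0 ≤ t → Bf β 0 t = Real.exp (-E t) := fun t ht => by
    rw [Bf, hI 0 t le_rfl ht]
  have ht : ∀ᶠ t in nhdsWithin s (Set.Ioi s), s < t := self_mem_nhdsWithin
  have hCpos : ∀ t, s < t → 0 < C t := fun t ht =>
    intervalIntegral.intervalIntegral_pos_of_pos (hw.intervalIntegrable _ _) hwpos ht
  have hslope : ∀ {g : ℝ → ℝ} {g' : ℝ}, HasDerivAt g g' s →
      Tendsto (fun t => (g t - g s) / (t - s)) (nhdsWithin s (Set.Ioi s)) (nhds g') := fun hg => by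
    simpa only [slope_fun_def_field] using
      (hasDerivAt_iff_tendsto_slope_left_right.mp hg).2
  have key := tendsto_poissonGammaMix_sub_div (l := nhdsWithin s (Set.Ioi s))
    (a := fun t => y * Real.exp (E s - E t)) (q := fun t => Real.exp (-E t) * C t)
    (h := fun t => t - s) (y := y) (α := -β s * y) (κ := σ s ^ 2 / 2)
    (contDiff_infty.mp hf 3) hsupp ?_ ?_ ?_ ?_ ?_ ?_
  · refine key.congr' ?_
    filter_upwards [ht] with t ht
    have hCt := hCpos t ht
    have hθ : y * Real.exp (E s - E t) / (Real.exp (-E t) * C t) =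
        y * (1 / (Real.exp (-E s) * C t)) := by
      rw [sub_eq_add_neg, Real.exp_add, Real.exp_neg (E s)]
      field_simp
    rw [hθ, Hm, gf, pf, hC_eq t ht.le, hB_eq s hs, hB_eq t (hs.trans ht.le)]
  · filter_upwards [ht] with t ht using sub_pos.mpr ht
  · refine Tendsto.mono_left ?_ nhdsWithin_le_nhds
    simpa using (continuous_sub_right s).tendsto s
  · exact Eventually.of_forall fun t => by positivity
  · filter_upwards [ht] with t ht
    have := hCpos t ht
    positivity
  · have hd : HasDerivAt (fun t => y * Real.exp (E s - E t)) (-β s * y) s := by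
      convert! (((hE s).const_sub (E s)).exp.const_mul y) using 1
      rw [hβ_eq s hs]
      simp
      ring
    simpa using hslope hd
  · have hd : HasDerivAt (fun t => Real.exp (-E t) * C t) (σ s ^ 2 / 2) s := by
      convert! (hE s).neg.exp.mul hC using 1
      simp [C, w, hσ_eq s hs, Real.exp_neg]
      field_simp
    simpa [C] using hslope hd
end

section
/- Let α : [0,∞) → ℝ be nonnegative, right-continuous and bounded, and fix 0 ≤ t₁ < t₂ < t₃ < ∞. Suppose μ₁₂, μ₂₃ and μ₁₃ are probability measures on [0,∞) whose Laplace transforms are λ ↦ exp(−∫_{t₁}^{t₂} (σ²(v)/2)α(v)Ψ_{v,t₂}(λ)dv), λ ↦ exp(−∫_{t₂}^{t₃} (σ²(v)/2)α(v)Ψ_{v,t₃}(λ)dv) and λ ↦ exp(−∫_{t₁}^{t₃} (σ²(v)/2)α(v)Ψ_{v,t₃}(λ)dv) respectively. Then the skew convolution property (μ₁₂ H_{t₂,t₃}) ∗ μ₂₃ = μ₁₃ holds, where μH_{s,t} denotes the measure A ↦ ∫_{[0,∞)} H_{s,t}(y,A) μ(dy) and ∗ denotes convolution of measures on [0,∞).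 -/
open MeasureTheory Filter Set

/-- `Ψ_{s,t}(λ) = γ(s,t)·λ/(p(s,t)+λ)` -/
noncomputable def Psi (σ β : ℝ → ℝ) (s t l : ℝ) : ℝ :=
  gf σ β s t * l / (pf σ β s t + l)
/-- Two measures on `ℝ` with `∫ e^{-nx} ≤ 1` and the same Laplace transform at every natural
number are equal. -/
lemma MeasureTheory.Measure.ext_of_lintegral_exp_neg_natCast {μ ν : Measure ℝ}
    (hμ : ∀ n : ℕ, ∫⁻ x, ENNReal.ofReal (Real.exp (-(n * x))) ∂μ ≤ 1)
    (h : ∀ n : ℕ, ∫⁻ x, ENNReal.ofReal (Real.exp (-(n * x))) ∂μ =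
      ∫⁻ x, ENNReal.ofReal (Real.exp (-(n * x))) ∂ν) : μ = ν := by
  have hν : ∀ n : ℕ, ∫⁻ x, ENNReal.ofReal (Real.exp (-(n * x))) ∂ν ≤ 1 := fun n => h n ▸ hμ n
  have hfin : ∀ {κ : Measure ℝ}, (∀ n : ℕ, ∫⁻ x, ENNReal.ofReal (Real.exp (-(n * x))) ∂κ ≤ 1) →
      IsFiniteMeasure κ := fun {κ} hκ => ⟨by
    have := hκ 0
    simp only [CharP.cast_eq_zero, zero_mul, neg_zero, Real.exp_zero, ENNReal.ofReal_one,
      lintegral_const, one_mul] at this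
    exact this.trans_lt ENNReal.one_lt_top⟩
  have series : ∀ {κ : Measure ℝ},
      (∀ n : ℕ, ∫⁻ x, ENNReal.ofReal (Real.exp (-(n * x))) ∂κ ≤ 1) → ∀ z : ℂ,
      ProbabilityTheory.complexMGF (fun x => Real.exp (-x)) κ z = ∑' n : ℕ, z ^ n / n.factorial *
        ((∫⁻ x, ENNReal.ofReal (Real.exp (-(n * x))) ∂κ).toReal : ℂ) := by
    intro κ hκ z
    have hexp_int : ∀ n : ℕ, Integrable (fun x : ℝ => Real.exp (-(n * x))) κ := fun n =>
      (lintegral_ofReal_ne_top_iff_integrable (by fun_prop) (ae_of_all _ fun x => by positivity)).1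
        ((hκ n).trans_lt ENNReal.one_lt_top).ne
    have hval : ∀ n : ℕ, ∫ x, Real.exp (-(n * x)) ∂κ =
        (∫⁻ x, ENNReal.ofReal (Real.exp (-(n * x))) ∂κ).toReal := fun n =>
      integral_eq_lintegral_of_nonneg_ae (ae_of_all _ fun x => by positivity) (by fun_prop)
    have hle : ∀ n : ℕ, ∫ x, Real.exp (-(n * x)) ∂κ ≤ 1 := fun n => by
      rw [hval]
      exact ENNReal.toReal_le_of_le_ofReal zero_le_one (by simpa using hκ n)
    have key := hasSum_integral_of_summable_integral_norm (μ := κ)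
      (F := fun (n : ℕ) (x : ℝ) => z ^ n / n.factorial * (Real.exp (-(n * x)) : ℂ))
      (fun n => (hexp_int n).ofReal.const_mul _) (by
        refine Summable.of_nonneg_of_le (fun n => integral_nonneg fun x => norm_nonneg _)
          (fun n => ?_) (Real.summable_pow_div_factorial ‖z‖)
        have : ∀ x : ℝ, ‖z ^ n / n.factorial * (Real.exp (-(n * x)) : ℂ)‖ =
            ‖z‖ ^ n / n.factorial * Real.exp (-(n * x)) := fun x => by
          rw [norm_mul, norm_div, norm_pow, Complex.norm_natCast, Complex.norm_real,
            Real.norm_of_nonneg (Real.exp_pos _).le]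
        simp_rw [this, integral_const_mul]
        exact mul_le_of_le_one_right (by positivity) (hle n))
    have hexp : ∀ x : ℝ, ∑' n : ℕ, z ^ n / n.factorial * (Real.exp (-(n * x)) : ℂ) =
        Complex.exp (z * Real.exp (-x)) := fun x => by
      rw [Complex.exp_eq_exp_ℂ, ← (NormedSpace.expSeries_div_hasSum_exp _).tsum_eq]
      refine tsum_congr fun n => ?_
      rw [mul_pow, ← Complex.ofReal_pow, ← Real.exp_nat_mul, mul_neg]
      ring
    rw [ProbabilityTheory.complexMGF]
    simp_rw [hexp] at key
    rw [← key.tsum_eq]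
    refine tsum_congr fun n => ?_
    rw [integral_const_mul, integral_complex_ofReal, hval]
  have := hfin hμ
  have := hfin hν
  have hmap : μ.map (fun x => Real.exp (-x)) = ν.map (fun x => Real.exp (-x)) := by
    refine Measure.ext_of_complexMGF_eq (by fun_prop) (by fun_prop) (funext fun z => ?_)
    rw [series hμ, series hν]
    simp_rw [h]
  have inv : ∀ κ : Measure ℝ, (κ.map (fun x => Real.exp (-x))).map (fun y => -Real.log y) = κ :=
    fun κ => by
      rw [Measure.map_map (by fun_prop) (by fun_prop)]
      convert! Measure.map_id
      ext x
      simp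
  rw [← inv μ, hmap, inv]

section Laplace
open ProbabilityTheory

lemma lintegral_exp_neg_mul_gammaMeasure {a p l : ℝ} (ha : 0 < a) (hp : 0 < p) (hl : 0 ≤ l) :
    ∫⁻ x, ENNReal.ofReal (Real.exp (-(l * x))) ∂gammaMeasure a p =
      ENNReal.ofReal ((p / (p + l)) ^ a) := by
  have hpl : 0 < p + l := by positivity
  have hm : ∀ r, Measurable (gammaPDF a r) := fun r => (measurable_gammaPDFReal a r).ennreal_ofReal
  rw [gammaMeasure, lintegral_withDensity_eq_lintegral_mul _ (hm p) (by fun_prop)]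
  have : ∀ x, (gammaPDF a p * fun x => ENNReal.ofReal (Real.exp (-(l * x)))) x =
      ENNReal.ofReal ((p / (p + l)) ^ a) * gammaPDF a (p + l) x := fun x => by
    rw [Pi.mul_apply, gammaPDF, gammaPDF, ← ENNReal.ofReal_mul (gammaPDFReal_nonneg ha hp x),
      ← ENNReal.ofReal_mul (by positivity)]
    congr 1
    unfold gammaPDFReal
    split_ifs with hx
    · rw [show -((p + l) * x) = -(p * x) + -(l * x) by ring, Real.exp_add,
        Real.div_rpow hp.le hpl.le]
      have := (Real.rpow_pos_of_pos hpl a).ne'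
      field_simp
    · simp
  simp_rw [this]
  rw [lintegral_const_mul _ (hm _), lintegral_gammaPDF_eq_one ha hpl, mul_one]

lemma lintegral_exp_neg_mul_poissonGammaMix {θ p l : ℝ} (hθ : 0 ≤ θ) (hp : 0 < p) (hl : 0 ≤ l) :
    ∫⁻ x, ENNReal.ofReal (Real.exp (-(l * x))) ∂poissonGammaMix θ p =
      ENNReal.ofReal (Real.exp (-(θ * (l / (p + l))))) := by
  have hpl : 0 < p + l := by positivity
  set q := p / (p + l) with hq
  have hq0 : 0 ≤ q := by positivity
  have hsum : HasSum (fun n : ℕ => Real.exp (-θ) * ((θ * q) ^ n / n.factorial))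
      (Real.exp (-θ) * Real.exp (θ * q)) := by
    rw [Real.exp_eq_exp_ℝ]
    exact (NormedSpace.expSeries_div_hasSum_exp (θ * q)).mul_left _
  have hval : Real.exp (-(θ * (l / (p + l)))) = Real.exp (-θ) * Real.exp (θ * q) := by
    rw [← Real.exp_add, hq]
    congr 1
    field_simp
    ring
  rw [hval, ← hsum.tsum_eq, ENNReal.ofReal_tsum_of_nonneg (fun n => by positivity) hsum.summable,
    tsum_eq_zero_add' ENNReal.summable, poissonGammaMix, lintegral_add_measure,
    lintegral_sum_measure]
  simp_rw [lintegral_smul_measure]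
  rw [lintegral_dirac]
  congr 1
  · simp
  · refine tsum_congr fun m => ?_
    rw [lintegral_exp_neg_mul_gammaMeasure (by positivity) hp hl, smul_eq_mul,
      ← ENNReal.ofReal_mul (by positivity), ← hq, ← Nat.cast_add_one, Real.rpow_natCast]
    congr 1
    rw [mul_pow]
    ring

lemma measurable_poissonGammaMix (p : ℝ) : Measurable fun θ => poissonGammaMix θ p := by
  refine Measure.measurable_of_measurable_coe _ fun s hs => ?_
  simp only [poissonGammaMix, Measure.add_apply, Measure.sum_apply _ hs, Measure.smul_apply,
    smul_eq_mul]
  refine Measurable.add (by fun_prop) (Measurable.tsum fun m => ?_)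
  fun_prop

lemma lintegral_exp_neg_mul_eq_ofReal_integral {μ : Measure ℝ} [IsFiniteMeasure μ]
    (hμ : μ (Set.Ici (0:ℝ))ᶜ = 0) {l : ℝ} (hl : 0 ≤ l) :
    ∫⁻ x, ENNReal.ofReal (Real.exp (-(l * x))) ∂μ =
      ENNReal.ofReal (∫ x, Real.exp (-(l * x)) ∂μ) := by
  refine (ofReal_integral_eq_lintegral_ofReal ?_ (ae_of_all _ fun x => by positivity)).symm
  refine Integrable.of_bound (C := 1) (by fun_prop) ?_
  have : ∀ᵐ x ∂μ, x ∈ Set.Ici (0:ℝ) := mem_ae_iff.2 hμ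
  filter_upwards [this] with x hx
  rw [Real.norm_of_nonneg (Real.exp_pos _).le, Real.exp_le_one_iff]
  exact neg_nonpos.2 (mul_nonneg hl hx)

end Laplace

lemma measurable_of_continuousWithinAt_Ici {f : ℝ → ℝ}
    (hf : ∀ x, ContinuousWithinAt f (Set.Ici x) x) : Measurable f := by
  refine measurable_of_tendsto_metrizable
    (f := fun (n : ℕ) x => f ((⌊(n + 1 : ℝ) * x⌋ + 1 : ℤ) / (n + 1 : ℝ))) (fun n => ?_) ?_
  · exact (measurable_from_top (f := fun k : ℤ => f ((k + 1 : ℤ) / (n + 1 : ℝ)))).comp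
      (Int.measurable_floor.comp (measurable_const_mul _))
  · refine tendsto_pi_nhds.2 fun x => (hf x).tendsto.comp (tendsto_nhdsWithin_iff.2 ⟨?_, ?_⟩)
    · refine tendsto_of_tendsto_of_tendsto_of_le_of_le (tendsto_const_nhds (x := x))
        (h := fun n : ℕ => x + 1 / (n + 1 : ℝ)) ?_ ?_ ?_
      · simpa using tendsto_const_nhds.add (tendsto_one_div_add_atTop_nhds_zero_nat (𝕜 := ℝ))
      · intro n
        have hn : (0:ℝ) < n + 1 := by positivity
        rw [le_div_iff₀ hn, mul_comm]
        push_cast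
        exact (Int.lt_floor_add_one _).le
      · intro n
        have hn : (0:ℝ) < n + 1 := by positivity
        have := Int.floor_le ((n + 1 : ℝ) * x)
        push_cast
        have hx : (x + 1 / (n + 1 : ℝ)) * (n + 1) = (n + 1) * x + 1 := by
          field_simp
        rw [div_le_iff₀ hn, hx]
        linarith
    · refine Eventually.of_forall fun n => ?_
      have hn : (0:ℝ) < n + 1 := by positivity
      rw [Set.mem_Ici, le_div_iff₀ hn, mul_comm]
      push_cast
      exact (Int.lt_floor_add_one _).le

section Cumulant
variable {σ β : ℝ → ℝ}

lemma intervalIntegrable_of_continuousOn_Ici {f : ℝ → ℝ} (hf : ContinuousOn f (Set.Ici 0))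
    {s t : ℝ} (hs : 0 ≤ s) (ht : 0 ≤ t) : IntervalIntegrable f volume s t :=
  (hf.mono fun _ hx => (le_min hs ht).trans hx.1).intervalIntegrable

lemma continuousOn_primitive_Ici {f : ℝ → ℝ} (hf : ContinuousOn f (Set.Ici 0)) :
    ContinuousOn (fun v => ∫ u in (0:ℝ)..v, f u) (Set.Ici 0) := by
  intro x hx
  have hx : (0:ℝ) ≤ x := hx
  have hc := intervalIntegral.continuousOn_primitive_interval'
    (intervalIntegrable_of_continuousOn_Ici hf le_rfl (by linarith : (0:ℝ) ≤ x + 1))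
    Set.left_mem_uIcc
  rw [Set.uIcc_of_le (by linarith)] at hc
  refine (hc x ⟨hx, by linarith⟩).mono_of_mem_nhdsWithin ?_
  filter_upwards [self_mem_nhdsWithin, mem_nhdsWithin_of_mem_nhds (Iio_mem_nhds (lt_add_one x))]
    with y hy hy' using ⟨hy, le_of_lt hy'⟩

lemma Bf_pos (β : ℝ → ℝ) (s t : ℝ) : 0 < Bf β s t := Real.exp_pos _

lemma continuousOn_Bf (hβc : ContinuousOn β (Set.Ici 0)) :
    ContinuousOn (fun v => Bf β 0 v) (Set.Ici 0) :=
  (continuousOn_primitive_Ici hβc).neg.rexp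

lemma continuousOn_Cf_integrand (hσc : ContinuousOn σ (Set.Ici 0))
    (hβc : ContinuousOn β (Set.Ici 0)) :
    ContinuousOn (fun v => σ v ^ 2 / 2 * Real.exp (∫ u in (0:ℝ)..v, β u)) (Set.Ici 0) :=
  ((hσc.pow 2).div_const 2).mul (continuousOn_primitive_Ici hβc).rexp

lemma Cf_pos (hσc : ContinuousOn σ (Set.Ici 0)) (hβc : ContinuousOn β (Set.Ici 0))
    (hσpos : ∀ x ∈ Set.Ici (0:ℝ), 0 < σ x) {s t : ℝ} (hs : 0 ≤ s) (hst : s < t) :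
    0 < Cf σ β s t := by
  refine intervalIntegral.intervalIntegral_pos_of_pos_on (intervalIntegrable_of_continuousOn_Ici
    (continuousOn_Cf_integrand hσc hβc) hs (hs.trans hst.le)) (fun x hx => ?_) hst
  have := hσpos x (hs.trans hx.1.le)
  positivity

lemma Cf_add (hσc : ContinuousOn σ (Set.Ici 0)) (hβc : ContinuousOn β (Set.Ici 0))
    {r s t : ℝ} (hr : 0 ≤ r) (hs : 0 ≤ s) (ht : 0 ≤ t) :
    Cf σ β r s + Cf σ β s t = Cf σ β r t :=
  intervalIntegral.integral_add_adjacent_intervals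
    (intervalIntegrable_of_continuousOn_Ici (continuousOn_Cf_integrand hσc hβc) hr hs)
    (intervalIntegrable_of_continuousOn_Ici (continuousOn_Cf_integrand hσc hβc) hs ht)

/-- A form of `Ψ_{s,t}(λ)` that makes sense, and is continuous, up to `s = t`. -/
lemma Psi_eq (hσc : ContinuousOn σ (Set.Ici 0)) (hβc : ContinuousOn β (Set.Ici 0))
    (hσpos : ∀ x ∈ Set.Ici (0:ℝ), 0 < σ x) {s t l : ℝ} (hs : 0 ≤ s) (hst : s < t) (hl : 0 ≤ l) :
    Psi σ β s t l = l * Bf β 0 t / (Bf β 0 s * (1 + l * Bf β 0 t * Cf σ β s t)) := by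
  have hC := Cf_pos hσc hβc hσpos hs hst
  have hBs := Bf_pos β 0 s
  have hBt := Bf_pos β 0 t
  have h1 : 0 < 1 + l * Bf β 0 t * Cf σ β s t := by positivity
  have h2 : 0 < 1 / (Bf β 0 t * Cf σ β s t) + l := by positivity
  rw [Psi, gf, pf, div_eq_div_iff h2.ne' (by positivity)]
  field_simp

lemma Psi_nonneg (hσc : ContinuousOn σ (Set.Ici 0)) (hβc : ContinuousOn β (Set.Ici 0))
    (hσpos : ∀ x ∈ Set.Ici (0:ℝ), 0 < σ x) {s t l : ℝ} (hs : 0 ≤ s) (hst : s < t) (hl : 0 ≤ l) :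
    0 ≤ Psi σ β s t l := by
  have hC := Cf_pos hσc hβc hσpos hs hst
  have hBs := Bf_pos β 0 s
  have hBt := Bf_pos β 0 t
  rw [Psi_eq hσc hβc hσpos hs hst hl]
  positivity

lemma Psi_Psi (hσc : ContinuousOn σ (Set.Ici 0)) (hβc : ContinuousOn β (Set.Ici 0))
    (hσpos : ∀ x ∈ Set.Ici (0:ℝ), 0 < σ x) {r s t l : ℝ} (hr : 0 ≤ r) (hrs : r < s) (hst : s < t)
    (hl : 0 ≤ l) : Psi σ β r s (Psi σ β s t l) = Psi σ β r t l := by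
  have hs := hr.trans hrs.le
  have hC := Cf_pos hσc hβc hσpos hr hrs
  have hC' := Cf_pos hσc hβc hσpos hs hst
  have hBr := Bf_pos β 0 r
  have hBs := Bf_pos β 0 s
  have hBt := Bf_pos β 0 t
  rw [Psi_eq hσc hβc hσpos hr hrs (Psi_nonneg hσc hβc hσpos hs hst hl),
    Psi_eq hσc hβc hσpos hs hst hl, Psi_eq hσc hβc hσpos hr (hrs.trans hst) hl,
    ← Cf_add hσc hβc hr hs (hs.trans hst.le)]
  have h1 : 0 < 1 + l * Bf β 0 t * Cf σ β s t := by positivity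
  have h2 : 0 < 1 + l * Bf β 0 t * (Cf σ β r s + Cf σ β s t) := by positivity
  have h3 : l * Bf β 0 t / (Bf β 0 s * (1 + l * Bf β 0 t * Cf σ β s t)) * Bf β 0 s =
      l * Bf β 0 t / (1 + l * Bf β 0 t * Cf σ β s t) := by
    field_simp
  rw [h3]
  have h4 : 1 + l * Bf β 0 t / (1 + l * Bf β 0 t * Cf σ β s t) * Cf σ β r s =
      (1 + l * Bf β 0 t * (Cf σ β r s + Cf σ β s t)) / (1 + l * Bf β 0 t * Cf σ β s t) := by
    field_simp
    ring
  rw [h4]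
  field_simp

lemma intervalIntegrable_mul_Psi (hσc : ContinuousOn σ (Set.Ici 0))
    (hβc : ContinuousOn β (Set.Ici 0)) (hσpos : ∀ x ∈ Set.Ici (0:ℝ), 0 < σ x)
    {α : ℝ → ℝ} (hαnn : ∀ x ∈ Set.Ici (0:ℝ), 0 ≤ α x)
    (hαrc : ∀ x ∈ Set.Ici (0:ℝ), ContinuousWithinAt α (Set.Ici x) x)
    {M : ℝ} (hαbd : ∀ x ∈ Set.Ici (0:ℝ), α x ≤ M)
    {a b t l : ℝ} (ha : 0 ≤ a) (hab : a ≤ b) (hbt : b ≤ t) (hl : 0 ≤ l) :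
    IntervalIntegrable (fun v => σ v ^ 2 / 2 * α v * Psi σ β v t l) volume a b := by
  have hsub : Set.uIcc a b ⊆ Set.Ici 0 := by
    rw [Set.uIcc_of_le hab]
    exact fun x hx => ha.trans hx.1
  have hα : IntervalIntegrable α volume a b := by
    have hm : Measurable fun x => α (max 0 x) := measurable_of_continuousWithinAt_Ici fun x =>
      (hαrc (max 0 x) (Set.mem_Ici.2 (le_max_left _ _))).comp
        (continuous_const.max continuous_id).continuousWithinAt
        fun y hy => Set.mem_Ici.2 (max_le_max le_rfl (Set.mem_Ici.1 hy))
    refine IntervalIntegrable.congr (f := fun x => α (max 0 x)) (fun x hx => ?_) ?_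
    · simp only [max_eq_right (Set.mem_Ici.1 (hsub (Set.uIoc_subset_uIcc hx)))]
    · rw [intervalIntegrable_iff]
      refine Measure.integrableOn_of_bounded (M := M) (by simp) hm.aestronglyMeasurable
        (ae_of_all _ fun x => ?_)
      rw [Real.norm_of_nonneg (hαnn _ (Set.mem_Ici.2 (le_max_left _ _)))]
      exact hαbd _ (Set.mem_Ici.2 (le_max_left _ _))
  have hC : ContinuousOn (fun v => Cf σ β v t) (Set.uIcc a b) := by
    have h := intervalIntegral.continuousOn_primitive_interval_left (a := a) (b := t)
      (f := fun v => σ v ^ 2 / 2 * Real.exp (∫ u in (0:ℝ)..v, β u)) (μ := volume) (by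
        refine (ContinuousOn.mono (continuousOn_Cf_integrand hσc hβc) ?_).integrableOn_compact
          isCompact_uIcc
        rw [Set.uIcc_of_le (hab.trans hbt)]
        exact fun x hx => ha.trans hx.1)
    refine h.mono ?_
    rw [Set.uIcc_of_le hab, Set.uIcc_of_le (hab.trans hbt)]
    exact Set.Icc_subset_Icc le_rfl hbt
  have hBt := Bf_pos β 0 t
  have hcont : ContinuousOn (fun v => σ v ^ 2 / 2 *
      (l * Bf β 0 t / (Bf β 0 v * (1 + l * Bf β 0 t * Cf σ β v t)))) (Set.uIcc a b) := by
    refine (((hσc.mono hsub).pow 2).div_const 2).mul (continuousOn_const.div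
      (((continuousOn_Bf hβc).mono hsub).mul
        (continuousOn_const.add (continuousOn_const.mul hC))) fun v hv => ?_)
    have hv0 : 0 ≤ v := hsub hv
    rw [Set.uIcc_of_le hab] at hv
    have hCnn : 0 ≤ Cf σ β v t := by
      rcases (hv.2.trans hbt).eq_or_lt with rfl | hlt
      · simp [Cf]
      · exact (Cf_pos hσc hβc hσpos hv0 hlt).le
    have hBv := Bf_pos β 0 v
    positivity
  refine (hα.mul_continuousOn hcont).congr_ae ?_
  rw [Filter.EventuallyEq, ae_restrict_iff' measurableSet_uIoc]
  filter_upwards [Measure.ae_ne volume t] with v hvt hv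
  rw [Set.uIoc_of_le hab] at hv
  rw [Psi_eq hσc hβc hσpos (ha.trans hv.1.le) (lt_of_le_of_ne (hv.2.trans hbt) hvt) hl]
  ring

end Cumulant

/-- Skew convolution property `(I_{t₁,t₂} H_{t₂,t₃}) ∗ I_{t₂,t₃} = I_{t₁,t₃}` for the
family of laws with Laplace transforms `exp(−∫ (σ²(v)/2)α(v)Ψ_{v,·}(λ)dv)`. -/
theorem stmt_16 (σ β : ℝ → ℝ)
    (hσc : ContinuousOn σ (Set.Ici 0)) (hβc : ContinuousOn β (Set.Ici 0))
    (hσpos : ∀ x ∈ Set.Ici (0:ℝ), 0 < σ x) (hβnn : ∀ x ∈ Set.Ici (0:ℝ), 0 ≤ β x)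
    (α : ℝ → ℝ) (hαnn : ∀ x ∈ Set.Ici (0:ℝ), 0 ≤ α x)
    (hαrc : ∀ x ∈ Set.Ici (0:ℝ), ContinuousWithinAt α (Set.Ici x) x)
    (M : ℝ) (hαbd : ∀ x ∈ Set.Ici (0:ℝ), α x ≤ M)
    (t₁ t₂ t₃ : ℝ) (h₁ : 0 ≤ t₁) (h₁₂ : t₁ < t₂) (h₂₃ : t₂ < t₃)
    (μ₁₂ μ₂₃ μ₁₃ : Measure ℝ)
    (hP₁₂ : IsProbabilityMeasure μ₁₂) (hP₂₃ : IsProbabilityMeasure μ₂₃)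
    (hP₁₃ : IsProbabilityMeasure μ₁₃)
    (h₁₂sup : μ₁₂ (Set.Ici (0:ℝ))ᶜ = 0) (h₂₃sup : μ₂₃ (Set.Ici (0:ℝ))ᶜ = 0)
    (h₁₃sup : μ₁₃ (Set.Ici (0:ℝ))ᶜ = 0)
    (hL₁₂ : ∀ l : ℝ, 0 ≤ l → (∫ x, Real.exp (-(l * x)) ∂μ₁₂) =
      Real.exp (-∫ v in t₁..t₂, σ v ^ 2 / 2 * α v * Psi σ β v t₂ l))
    (hL₂₃ : ∀ l : ℝ, 0 ≤ l → (∫ x, Real.exp (-(l * x)) ∂μ₂₃) =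
      Real.exp (-∫ v in t₂..t₃, σ v ^ 2 / 2 * α v * Psi σ β v t₃ l))
    (hL₁₃ : ∀ l : ℝ, 0 ≤ l → (∫ x, Real.exp (-(l * x)) ∂μ₁₃) =
      Real.exp (-∫ v in t₁..t₃, σ v ^ 2 / 2 * α v * Psi σ β v t₃ l)) :
    Measure.conv (μ₁₂.bind (fun y => Hm σ β t₂ t₃ y)) μ₂₃ = μ₁₃ := by
  have ht₂ : 0 ≤ t₂ := h₁.trans h₁₂.le
  have hC := Cf_pos hσc hβc hσpos ht₂ h₂₃
  have hp : 0 < pf σ β t₂ t₃ := one_div_pos.2 (mul_pos (Bf_pos _ _ _) hC)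
  have hg : 0 < gf σ β t₂ t₃ := one_div_pos.2 (mul_pos (Bf_pos _ _ _) hC)
  have hmeas : Measurable fun y => Hm σ β t₂ t₃ y :=
    (measurable_poissonGammaMix (pf σ β t₂ t₃)).comp (measurable_id.mul_const (gf σ β t₂ t₃))
  have hexp : ∀ l : ℝ, Measurable fun x : ℝ => ENNReal.ofReal (Real.exp (-(l * x))) :=
    fun l => by fun_prop
  have hbind : ∀ l : ℝ, 0 ≤ l →
      ∫⁻ x, ENNReal.ofReal (Real.exp (-(l * x))) ∂(μ₁₂.bind fun y => Hm σ β t₂ t₃ y) =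
      ENNReal.ofReal (Real.exp (-∫ v in t₁..t₂, σ v ^ 2 / 2 * α v * Psi σ β v t₃ l)) := by
    intro l hl
    rw [Measure.lintegral_bind hmeas.aemeasurable (hexp l).aemeasurable]
    have hpt : ∀ᵐ y ∂μ₁₂, ∫⁻ x, ENNReal.ofReal (Real.exp (-(l * x))) ∂(Hm σ β t₂ t₃ y) =
        ENNReal.ofReal (Real.exp (-(Psi σ β t₂ t₃ l * y))) := by
      have hae : ∀ᵐ y ∂μ₁₂, y ∈ Set.Ici (0:ℝ) := mem_ae_iff.2 h₁₂sup
      filter_upwards [hae] with y hy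
      rw [Hm, lintegral_exp_neg_mul_poissonGammaMix (mul_nonneg hy hg.le) hp hl, Psi]
      ring_nf
    have hΨ := Psi_nonneg hσc hβc hσpos ht₂ h₂₃ hl
    rw [lintegral_congr_ae hpt, lintegral_exp_neg_mul_eq_ofReal_integral h₁₂sup hΨ, hL₁₂ _ hΨ]
    congr 3
    refine intervalIntegral.integral_congr_ae ?_
    filter_upwards [Measure.ae_ne volume t₂] with v hv2 hv
    rw [Set.uIoc_of_le h₁₂.le] at hv
    rw [Psi_Psi hσc hβc hσpos (h₁.trans hv.1.le) (lt_of_le_of_ne hv.2 hv2) h₂₃ hl]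
  have hconv : ∀ l : ℝ, 0 ≤ l →
      ∫⁻ x, ENNReal.ofReal (Real.exp (-(l * x))) ∂μ₁₃ = ∫⁻ x, ENNReal.ofReal (Real.exp (-(l * x)))
        ∂(Measure.conv (μ₁₂.bind fun y => Hm σ β t₂ t₃ y) μ₂₃) := by
    intro l hl
    rw [Measure.lintegral_conv (hexp l)]
    simp_rw [mul_add, neg_add, Real.exp_add, ENNReal.ofReal_mul (Real.exp_pos _).le]
    simp_rw [lintegral_const_mul _ (hexp l)]
    rw [lintegral_mul_const _ (hexp l), hbind l hl,
      lintegral_exp_neg_mul_eq_ofReal_integral h₂₃sup hl,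
      lintegral_exp_neg_mul_eq_ofReal_integral h₁₃sup hl, hL₂₃ l hl, hL₁₃ l hl,
      ← ENNReal.ofReal_mul (Real.exp_pos _).le, ← Real.exp_add, ← neg_add,
      intervalIntegral.integral_add_adjacent_intervals
        (intervalIntegrable_mul_Psi hσc hβc hσpos hαnn hαrc hαbd h₁ h₁₂.le h₂₃.le hl)
        (intervalIntegrable_mul_Psi hσc hβc hσpos hαnn hαrc hαbd ht₂ h₂₃.le le_rfl hl)]
  refine (Measure.ext_of_lintegral_exp_neg_natCast (fun n => ?_)
    fun n => hconv n n.cast_nonneg).symm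
  have hae : ∀ᵐ y ∂μ₁₃, y ∈ Set.Ici (0:ℝ) := mem_ae_iff.2 h₁₃sup
  calc ∫⁻ x, ENNReal.ofReal (Real.exp (-(n * x))) ∂μ₁₃ ≤ ∫⁻ _, 1 ∂μ₁₃ := by
        refine lintegral_mono_ae ?_
        filter_upwards [hae] with y hy
        rw [ENNReal.ofReal_le_one, Real.exp_le_one_iff]
        exact neg_nonpos.2 (mul_nonneg n.cast_nonneg hy)
    _ = 1 := by simp
end
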